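/- arXiv:1603.00092 — 3 statements merged into one kernel-verified Lean document; each statement's English description precedes it below -/
import Mathlib

section
/- Let D be a digraph partitioned into ψ vertex-disjoint K_i-IC structures (i = 1,...,ψ) covering all N vertices. Then the ICC scheme achieves an index code of length N − Σ_{i=1}^{ψ}(K_i − 1); in particular the optimal broadcast rate β(D) ≤ N − Σ_{i=1}^{ψ}(K_i − 1). -/
open Finset
open scoped Classical

universe u

variable {V : Type u}

/-- `l` is a directed cycle: nonempty, distinct vertices, consecutive arcs, wrap-around arc. -/
def IsCycle (A : V → V → Prop) (l : List V) : Prop :=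
  l ≠ [] ∧ l.Nodup ∧ l.Chain' A ∧
    ∀ a b, l.getLast? = some a → l.head? = some b → A a b

/-- `l` is a directed path from `i` to `j`. -/
def IsPath (A : V → V → Prop) (l : List V) (i j : V) : Prop :=
  l.Nodup ∧ l.Chain' A ∧ l.head? = some i ∧ l.getLast? = some j

/-- An I-path w.r.t. inner vertex set `VI`: a path between two distinct inner vertices
whose interior vertices are all non-inner. -/
def IsIPath [DecidableEq V] (A : V → V → Prop) (VI : Finset V) (l : List V) (i j : V) : Prop :=
  IsPath A l i j ∧ i ∈ VI ∧ j ∈ VI ∧ i ≠ j ∧ ∀ v ∈ l.dropLast.drop 1, v ∉ VI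

/-- An I-cycle: a directed cycle containing exactly one inner vertex. -/
def IsICycle [DecidableEq V] (A : V → V → Prop) (VI : Finset V) (l : List V) : Prop :=
  IsCycle A l ∧ (l.toFinset ∩ VI).card = 1

/-- A K-IC structure: exactly one I-path between each ordered pair of distinct inner
vertices, and no I-cycle. -/
def IsKIC [DecidableEq V] (A : V → V → Prop) (VI : Finset V) : Prop :=
  (∀ i ∈ VI, ∀ j ∈ VI, i ≠ j → ∃! l : List V, IsIPath A VI l i j) ∧
  ∀ l : List V, ¬ IsICycle A VI l

/-- Out-degree of a vertex. -/
noncomputable def outDeg [Fintype V] (A : V → V → Prop) (v : V) : ℕ :=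
  (univ.filter fun w => A v w).card

/-- Minimum out-degree of a digraph. -/
noncomputable def minOutDeg [Fintype V] [Nonempty V] (A : V → V → Prop) : ℕ :=
  univ.inf' univ_nonempty (outDeg A)

/-- Out-degree of `v` within the subdigraph induced on `s`. -/
noncomputable def outDegOn (A : V → V → Prop) (s : Finset V) (v : V) : ℕ :=
  (s.filter fun w => A v w).card

/-- Minimum out-degree of the subdigraph induced on `s` (0 if `s` is empty). -/
noncomputable def minOutDegOn (A : V → V → Prop) (s : Finset V) : ℕ :=
  if h : s.Nonempty then s.inf' h (outDegOn A s) else 0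

/-- Induced arc relation on a vertex subset. -/
def inducedRel (A : V → V → Prop) (s : Finset V) : V → V → Prop :=
  fun u v => u ∈ s ∧ v ∈ s ∧ A u v

/-- A valid index code of length `p` for `t`-bit messages: the messages of every receiver
are determined by the codeword together with its side information (its out-neighbours'
messages). -/
def IsIndexCode [Fintype V] (A : V → V → Prop) (t p : ℕ)
    (F : (V → (Fin t → ZMod 2)) → (Fin p → ZMod 2)) : Prop :=
  ∀ x y : V → (Fin t → ZMod 2), F x = F y →
    ∀ i : V, (∀ q, A i q → x q = y q) → x i = y i

/-- No directed cycle lies entirely inside `s`. -/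
def AcyclicOn (A : V → V → Prop) (s : Finset V) : Prop :=
  ∀ l : List V, IsCycle A l → ¬ (∀ v ∈ l, v ∈ s)

/-- `s` (as a partial clique) is minimal: its savings `δ⁺` strictly exceed the total
savings of any partition of `s` into at least two parts. -/
def IsMinimalPC [DecidableEq V] (A : V → V → Prop) (s : Finset V) : Prop :=
  ∀ P : Finpartition s, 2 ≤ P.parts.card →
    ∑ p ∈ P.parts, minOutDegOn A p < minOutDegOn A s

/-- A directed rooted tree inside the digraph `A`, rooted at inner vertex `i`, whose
leaves are exactly the other inner vertices and whose internal vertices are non-inner. -/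
structure IsICTree [DecidableEq V] (A : V → V → Prop) (VI : Finset V) (i : V)
    (T : V → V → Prop) : Prop where
  sub : ∀ u v, T u v → A u v
  root_mem : i ∈ VI
  root_no_parent : ∀ u, ¬ T u i
  unique_parent : ∀ u u' v, T u v → T u' v → u = u'
  reach : ∀ j ∈ VI, j ≠ i → Relation.ReflTransGen T i j
  leaf : ∀ j ∈ VI, j ≠ i → ∀ w, ¬ T j w
  connected : ∀ u v, T u v → Relation.ReflTransGen T i u
  acyclic : ∀ v, ¬ Relation.TransGen T v v

/-- The Class-A digraph on `3*m` vertices (`K = 2*m` inner vertices `0,…,K-1`,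
outer vertices `K,…,3m-1`): outer vertex `K+i` has arcs to inner `2i` and `2i+1`;
inner `2i` and `2i+1` have mutual arcs and arcs to every outer vertex except `K+i`. -/
def classARel (m : ℕ) : Fin (3 * m) → Fin (3 * m) → Prop := fun u v =>
  (2 * m ≤ u.val ∧ v.val < 2 * m ∧ v.val / 2 = u.val - 2 * m) ∨
  (u.val < 2 * m ∧ v.val < 2 * m ∧ u.val / 2 = v.val / 2 ∧ u ≠ v) ∨
  (u.val < 2 * m ∧ 2 * m ≤ v.val ∧ v.val - 2 * m ≠ u.val / 2)

/-- Arcs leaving a non-inner vertex. -/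
def OuterTail (B : V → V → Prop) (I : Finset V) (u v : V) : Prop := B u v ∧ u ∉ I

/-- Arcs entering a non-inner vertex. -/
def OuterHead (B : V → V → Prop) (I : Finset V) (u v : V) : Prop := B u v ∧ v ∉ I

/-- The inner vertices whose messages are summed at `v`: those reachable from `v` through
non-inner vertices, provided `v` itself is reachable from an inner vertex in that way. -/
noncomputable def leaves (B : V → V → Prop) (I : Finset V) (v : V) : Finset V :=
  I.filter fun r => (∃ i ∈ I, Relation.ReflTransGen (OuterHead B I) i v) ∧
    Relation.ReflTransGen (OuterTail B I) v r

theorem exists_nodup_chain {r : V → V → Prop} {a b : V} (h : Relation.ReflTransGen r a b) :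
    ∃ l : List V, (a :: l).Nodup ∧ (a :: l).IsChain r ∧ (a :: l).getLast? = some b := by
  induction h using Relation.ReflTransGen.head_induction_on with
  | refl => exact ⟨[], by simp, by simp, by simp⟩
  | @head a c hac _ ih =>
    obtain ⟨l, hn, hc, hl⟩ := ih
    by_cases ha : a ∈ c :: l
    · obtain ⟨s, t, hst⟩ := List.append_of_mem ha
      rw [hst] at hn hc hl
      refine ⟨t, (List.nodup_append.1 hn).2.1, (List.isChain_append.1 hc).2.1, ?_⟩
      simpa [List.getLast?_append] using hl
    · exact ⟨c :: l, List.nodup_cons.2 ⟨ha, hn⟩, List.isChain_cons_cons.2 ⟨hac, hc⟩,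
        by simpa [List.getLast?_cons_cons] using hl⟩

theorem reflTransGen_of_chain {r : V → V → Prop} {a b : V} {l : List V}
    (hc : (a :: l).IsChain r) (hl : (a :: l).getLast? = some b) :
    (∀ w ∈ a :: l, Relation.ReflTransGen r a w) ∧ ∀ w ∈ a :: l, Relation.ReflTransGen r w b := by
  induction l generalizing a with
  | nil =>
    simp at hl
    subst hl
    simp [Relation.ReflTransGen.refl]
  | cons c l ih =>
    rw [List.isChain_cons_cons] at hc
    rw [List.getLast?_cons_cons] at hl
    obtain ⟨h1, h2⟩ := ih hc.2 hl
    constructor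
    · intro w hw
      rcases List.mem_cons.1 hw with rfl | hw
      · exact .refl
      · exact .head hc.1 (h1 w hw)
    · intro w hw
      rcases List.mem_cons.1 hw with rfl | hw
      · exact .head hc.1 (h2 c (by simp))
      · exact h2 w hw

theorem tail_not_mem_of_chain {B : V → V → Prop} {I : Finset V} {a : V} {l : List V}
    (hc : (a :: l).IsChain (OuterHead B I)) : ∀ w ∈ l, w ∉ I := by
  induction l generalizing a with
  | nil => simp
  | cons c l ih =>
    rw [List.isChain_cons_cons] at hc
    intro w hw
    rcases List.mem_cons.1 hw with rfl | hw
    · exact hc.1.2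
    · exact ih hc.2 w hw

theorem dropLast_not_mem_of_chain {B : V → V → Prop} {I : Finset V} {a : V} {l : List V}
    (hc : (a :: l).IsChain (OuterTail B I)) : ∀ w ∈ (a :: l).dropLast, w ∉ I := by
  induction l generalizing a with
  | nil => simp
  | cons c l ih =>
    rw [List.isChain_cons_cons] at hc
    intro w hw
    rw [List.dropLast_cons_cons] at hw
    rcases List.mem_cons.1 hw with rfl | hw
    · exact hc.1.2
    · exact ih hc.2 w hw

theorem chain_of_dropLast_not_mem {B : V → V → Prop} {I : Finset V} {a : V} {l : List V}
    (hc : (a :: l).IsChain B) (hI : ∀ w ∈ (a :: l).dropLast, w ∉ I) :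
    (a :: l).IsChain (OuterTail B I) := by
  induction l generalizing a with
  | nil => simp
  | cons c l ih =>
    rw [List.isChain_cons_cons] at hc ⊢
    rw [List.dropLast_cons_cons] at hI
    exact ⟨⟨hc.1, hI a (by simp)⟩, ih hc.2 fun w hw => hI w (List.mem_cons_of_mem _ hw)⟩

/-- Extending a path that leaves an inner vertex `i` and ends at `j`, which lies on no cycle of
non-inner vertices, through `k` to an inner vertex `r`: then `r ≠ i`, and there is an I-path
whose part after a prefix depending only on `i` and `j` starts with `k`. -/
theorem exists_iPath_prefix [DecidableEq V] {B : V → V → Prop} {I : Finset V} (hIC : IsKIC B I)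
    {i j : V} (hi : i ∈ I) (hij : Relation.ReflTransGen (OuterHead B I) i j)
    (hj : ¬ Relation.TransGen (OuterTail B I) j j) :
    ∃ s : List V, ∀ k r, B j k → r ∈ I → Relation.ReflTransGen (OuterTail B I) k r →
      r ≠ i ∧ ∃ q, IsIPath B I (s ++ k :: q) i r := by
  obtain ⟨p, hpn, hpc, hpl⟩ := exists_nodup_chain hij
  have hpI := tail_not_mem_of_chain hpc
  refine ⟨i :: p, fun k r hjk hr hkr => ?_⟩
  obtain ⟨q, hqn, hqc, hql⟩ := exists_nodup_chain hkr
  have hqI := dropLast_not_mem_of_chain hqc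
  have hpB : (i :: p).IsChain B := hpc.imp fun _ _ h => h.1
  have hqB : (k :: q).IsChain B := hqc.imp fun _ _ h => h.1
  have hsB : (i :: p ++ k :: q).IsChain B := by
    refine List.isChain_append.2 ⟨hpB, hqB, fun x hx y hy => ?_⟩
    rw [hpl] at hx
    simp at hx hy
    subst hx hy
    exact hjk
  have hqsplit : (k :: q).dropLast ++ [r] = k :: q :=
    List.dropLast_append_getLast? r hql
  have hqmem : ∀ w ∈ k :: q, w ∈ I → w = r := by
    intro w hw hwI
    rw [← hqsplit, List.mem_append] at hw
    rcases hw with hw | hw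
    · exact absurd hwI (hqI w hw)
    · simpa using hw
  have hdisj : ∀ w ∈ p, w ∉ k :: q := by
    intro w hwp hwq
    have hpj : j ∉ I := by
      refine hpI j ?_
      have := List.mem_of_getLast? hpl
      rcases List.mem_cons.1 this with h | h
      · subst h
        cases p with
        | nil => simp at hwp
        | cons c p =>
          rw [List.getLast?_cons_cons] at hpl
          exact List.mem_of_getLast? hpl
      · exact h
    have hpt : ∀ (l : List V) (c : V), (c :: l).IsChain (OuterHead B I) → c ∉ I →
        (c :: l).IsChain (OuterTail B I) := by
      intro l
      induction l with
      | nil => simp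
      | cons d l ih =>
        intro c hc hcI
        rw [List.isChain_cons_cons] at hc ⊢
        exact ⟨⟨hc.1.1, hcI⟩, ih d hc.2 hc.1.2⟩
    cases p with
    | nil => simp at hwp
    | cons c p =>
      rw [List.isChain_cons_cons] at hpc
      rw [List.getLast?_cons_cons] at hpl
      have h1 := (reflTransGen_of_chain (hpt p c hpc.2 hpc.1.2) hpl).2 w hwp
      have h2 := (reflTransGen_of_chain hqc hql).1 w hwq
      exact hj (.head' ⟨hjk, hpj⟩ (h2.trans h1))
  have hpq : (p ++ k :: q).Nodup :=
    List.nodup_append.2 ⟨(List.nodup_cons.1 hpn).2, hqn,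
      fun a ha b hb hab => hdisj a ha (hab ▸ hb)⟩
  have hlast : (p ++ k :: q).getLast? = some r := by
    rw [List.getLast?_append, hql]; rfl
  have hri : r ≠ i := by
    rintro rfl
    refine hIC.2 (p ++ k :: q) ⟨⟨by simp, hpq, (List.isChain_cons.1 hsB).2, ?_⟩, ?_⟩
    · intro a b ha hb
      rw [hlast] at ha
      obtain rfl := Option.some.inj ha
      exact (List.isChain_cons.1 hsB).1 b hb
    · rw [Finset.card_eq_one]
      refine ⟨r, ?_⟩
      ext w
      simp only [Finset.mem_inter, List.mem_toFinset, List.mem_append, Finset.mem_singleton]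
      constructor
      · rintro ⟨hw | hw, hwI⟩
        · exact absurd hwI (hpI w hw)
        · exact hqmem w hw hwI
      · rintro rfl
        exact ⟨Or.inr (List.mem_of_getLast? hql), hr⟩
  refine ⟨hri, q, ⟨?_, hsB, by simp, ?_⟩, hi, hr, hri.symm, ?_⟩
  · rw [List.cons_append, List.nodup_cons]
    refine ⟨fun h => ?_, hpq⟩
    rcases List.mem_append.1 h with h | h
    · exact (List.nodup_cons.1 hpn).1 h
    · exact hri (hqmem i h hi).symm
  · rw [List.getLast?_append, hql]; rfl
  · intro w hw
    rw [List.dropLast_append_of_ne_nil (by simp)] at hw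
    simp only [List.cons_append, List.drop_succ_cons, List.drop_zero, List.mem_append] at hw
    rcases hw with hw | hw
    · exact hpI w hw
    · exact hqI w hw

theorem mem_leaves_of_adj {B : V → V → Prop} {I : Finset V} {i j k r : V} (hi : i ∈ I)
    (hij : Relation.ReflTransGen (OuterHead B I) i j) (hjk : B j k) (hr : r ∈ I)
    (hkr : Relation.ReflTransGen (OuterTail B I) k r) : r ∈ leaves B I k := by
  refine Finset.mem_filter.2 ⟨hr, ?_, hkr⟩
  by_cases hk : k ∈ I
  · exact ⟨k, hk, .refl⟩
  · exact ⟨i, hi, hij.tail ⟨hjk, hk⟩⟩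

theorem leaves_eq_singleton {B : V → V → Prop} {I : Finset V} {v : V} (hv : v ∈ I) :
    leaves B I v = {v} := by
  ext r
  simp only [leaves, Finset.mem_filter, Finset.mem_singleton]
  constructor
  · rintro ⟨-, -, h⟩
    rcases h.cases_head with h | ⟨c, hc, -⟩
    · exact h.symm
    · exact absurd hv hc.2
  · rintro rfl
    exact ⟨hv, ⟨r, hv, .refl⟩, .refl⟩

theorem sum_biUnion_leaves_eq_zero [Fintype V] [DecidableEq V] {M : Type*} [AddCommGroup M]
    {B : V → V → Prop} {I : Finset V} (hIC : IsKIC B I) {i j : V} (hi : i ∈ I)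
    (hij : Relation.ReflTransGen (OuterHead B I) i j)
    (hj : ¬ Relation.TransGen (OuterTail B I) j j) (d : V → M)
    (hd : ∀ k, B j k → ∑ r ∈ leaves B I k, d r = 0) :
    ∑ r ∈ (univ.filter fun k => B j k).biUnion (leaves B I), d r = 0 := by
  rw [Finset.sum_biUnion]
  · exact Finset.sum_eq_zero fun k hk => hd k (Finset.mem_filter.1 hk).2
  · obtain ⟨s, hs⟩ := exists_iPath_prefix hIC hi hij hj
    intro k hk k' hk' hne
    refine Finset.disjoint_left.2 fun r hr hr' => hne ?_
    simp only [Finset.coe_filter, Finset.mem_univ, true_and, Set.mem_ofPred_eq] at hk hk'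
    obtain ⟨hrI, -, hkr⟩ := Finset.mem_filter.1 hr
    obtain ⟨-, -, hkr'⟩ := Finset.mem_filter.1 hr'
    obtain ⟨hri, q, hq⟩ := hs k r hk hrI hkr
    obtain ⟨-, q', hq'⟩ := hs k' r hk' hrI hkr'
    have := (hIC.1 i hi r hrI hri.symm).unique hq hq'
    exact (List.cons.inj (List.append_cancel_left this)).1

/-- Decoding inside one IC structure, for the difference `d` of two message vectors with the
same codeword. -/
theorem IsKIC.decode [Fintype V] [DecidableEq V] {M : Type*} [AddCommGroup M]
    {B : V → V → Prop} {I : Finset V} (hIC : IsKIC B I) (d : V → M) (hsum : ∑ r ∈ I, d r = 0)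
    {j : V} (hj : j ∉ I → d j = ∑ r ∈ leaves B I j, d r)
    (hadj : ∀ k, B j k → k ∉ I → d k = ∑ r ∈ leaves B I k, d r)
    (hzero : ∀ k, B j k → d k = 0) : d j = 0 := by
  have hout : ∀ k, B j k → ∑ r ∈ leaves B I k, d r = 0 := by
    intro k hk
    by_cases hkI : k ∈ I
    · rw [leaves_eq_singleton hkI, Finset.sum_singleton, hzero k hk]
    · rw [← hadj k hk hkI, hzero k hk]
  by_cases hjI : j ∈ I
  · have hcyc : ¬ Relation.TransGen (OuterTail B I) j j := by
      intro h
      obtain ⟨c, hc, -⟩ := Relation.TransGen.head'_iff.1 h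
      exact hc.2 hjI
    have h0 := sum_biUnion_leaves_eq_zero hIC hjI .refl hcyc d hout
    have hset : (univ.filter fun k => B j k).biUnion (leaves B I) = I.erase j := by
      obtain ⟨s, hs⟩ := exists_iPath_prefix hIC hjI .refl hcyc
      ext r
      simp only [Finset.mem_biUnion, Finset.mem_filter, Finset.mem_univ, true_and,
        Finset.mem_erase]
      constructor
      · rintro ⟨k, hk, hr⟩
        obtain ⟨hrI, -, hkr⟩ := Finset.mem_filter.1 hr
        exact ⟨(hs k r hk hrI hkr).1, hrI⟩
      · rintro ⟨hrj, hrI⟩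
        obtain ⟨l, ⟨⟨-, hc, hh, hl⟩, -, -, -, hint⟩, -⟩ := hIC.1 j hjI r hrI hrj.symm
        match l, hh, hc, hl, hint with
        | [a], hh, _, hl, _ =>
          simp at hh hl
          exact absurd (hl.symm.trans hh) hrj
        | a :: k :: l, hh, hc, hl, hint =>
          simp at hh
          subst hh
          have hc' := List.isChain_cons_cons.1 hc
          rw [List.getLast?_cons_cons] at hl
          rw [List.dropLast_cons_cons, List.drop_succ_cons, List.drop_zero] at hint
          exact ⟨k, hc'.1, mem_leaves_of_adj hjI .refl hc'.1 hrI
            ((reflTransGen_of_chain (chain_of_dropLast_not_mem hc'.2 hint) hl).2 k (by simp))⟩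
    rw [hset] at h0
    rw [← Finset.add_sum_erase I d hjI, h0, add_zero] at hsum
    exact hsum
  · rw [hj hjI]
    by_cases hreach : ∃ i ∈ I, Relation.ReflTransGen (OuterHead B I) i j
    · obtain ⟨i, hi, hij⟩ := hreach
      by_cases hcyc : Relation.TransGen (OuterTail B I) j j
      · obtain ⟨k, hk, hkj⟩ := Relation.TransGen.head'_iff.1 hcyc
        rw [← hout k hk.1]
        congr 1
        ext r
        constructor
        · intro hr
          obtain ⟨hrI, -, hjr⟩ := Finset.mem_filter.1 hr
          exact mem_leaves_of_adj hi hij hk.1 hrI (hkj.trans hjr)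
        · intro hr
          obtain ⟨hrI, -, hkr⟩ := Finset.mem_filter.1 hr
          exact Finset.mem_filter.2 ⟨hrI, ⟨i, hi, hij⟩, .head hk hkr⟩
      · rw [← sum_biUnion_leaves_eq_zero hIC hi hij hcyc d hout]
        congr 1
        ext r
        simp only [Finset.mem_biUnion, Finset.mem_filter, Finset.mem_univ, true_and]
        constructor
        · intro hr
          obtain ⟨hrI, -, hjr⟩ := Finset.mem_filter.1 hr
          rcases hjr.cases_head with rfl | ⟨k, hk, hkr⟩
          · exact absurd hrI hjI
          · exact ⟨k, hk.1, mem_leaves_of_adj hi hij hk.1 hrI hkr⟩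
        · rintro ⟨k, hk, hr⟩
          obtain ⟨hrI, -, hkr⟩ := Finset.mem_filter.1 hr
          exact Finset.mem_filter.2 ⟨hrI, ⟨i, hi, hij⟩, .head ⟨hk, hjI⟩ hkr⟩
    · exact Finset.sum_eq_zero fun r hr => absurd (Finset.mem_filter.1 hr).2.1 hreach

/-- The ICC scheme: a partition of the digraph into ψ disjoint K_i-IC structures yields a
valid index code of length N − Σ (K_i − 1), so β(D) ≤ N − Σ (K_i − 1). -/
theorem stmt10 {V : Type u} [Fintype V] [DecidableEq V] (A : V → V → Prop)
    (ψ : ℕ) (part : Fin ψ → Finset V) (VI : Fin ψ → Finset V) (K : Fin ψ → ℕ)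
    (hdisj : ∀ a b : Fin ψ, a ≠ b → Disjoint (part a) (part b))
    (hcover : (univ : Finset (Fin ψ)).biUnion part = (univ : Finset V))
    (hsub : ∀ a, VI a ⊆ part a) (hKcard : ∀ a, (VI a).card = K a)
    (hK1 : ∀ a, 1 ≤ K a)
    (hIC : ∀ a, IsKIC (inducedRel A (part a)) (VI a)) :
    ∃ F, IsIndexCode A 1 (Fintype.card V - ∑ a : Fin ψ, (K a - 1)) F := by
  have hcov : ∀ v : V, ∃ a, v ∈ part a := fun v => by
    have := Finset.mem_univ v
    rw [← hcover] at this
    simpa using this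
  choose π hπ using hcov
  have hπeq : ∀ a v, v ∈ part a → π v = a := fun a v hv => by
    by_contra hne
    exact Finset.disjoint_left.1 (hdisj _ _ hne) (hπ v) hv
  have hne : ∀ a, (VI a).Nonempty := fun a => by
    rw [← Finset.card_pos, hKcard]
    exact hK1 a
  choose ρ hρ using hne
  let U : Finset V := univ.biUnion fun a => (VI a).erase (ρ a)
  have hU : U.card = ∑ a, (K a - 1) := by
    rw [Finset.card_biUnion]
    · exact Finset.sum_congr rfl fun a _ => by rw [Finset.card_erase_of_mem (hρ a), hKcard]
    · intro a _ b _ hab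
      exact (hdisj a b hab).mono ((Finset.erase_subset _ _).trans (hsub a))
        ((Finset.erase_subset _ _).trans (hsub b))
  have hmemU : ∀ v, v ∈ U → v ∈ VI (π v) ∧ v ≠ ρ (π v) := by
    intro v hv
    obtain ⟨a, -, ha⟩ := Finset.mem_biUnion.1 hv
    obtain ⟨h1, h2⟩ := Finset.mem_erase.1 ha
    rw [hπeq a v (hsub a h2)]
    exact ⟨h2, h1⟩
  have hcard : Fintype.card {v // v ∈ Uᶜ} = Fintype.card V - ∑ a, (K a - 1) := by
    rw [Fintype.card_coe, Finset.card_compl, hU]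
  let e := Fintype.equivFinOfCardEq hcard
  let G : (V → (Fin 1 → ZMod 2)) → V → Fin 1 → ZMod 2 := fun x v =>
    if v ∈ VI (π v) then ∑ r ∈ VI (π v), x r
    else x v - ∑ r ∈ leaves (inducedRel A (part (π v))) (VI (π v)) v, x r
  refine ⟨fun x n => G x (e.symm n).1 0, fun x y hxy j hside => ?_⟩
  have hG : ∀ v, v ∉ U → G x v = G y v := by
    intro v hv
    have := congrFun hxy (e ⟨v, Finset.mem_compl.2 hv⟩)
    simp only [Equiv.symm_apply_apply] at this
    ext n
    rwa [Subsingleton.elim n 0]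
  have hout : ∀ v, v ∉ VI (π v) → x v - y v =
      ∑ r ∈ leaves (inducedRel A (part (π v))) (VI (π v)) v, (x r - y r) := by
    intro v hv
    have := hG v fun h => hv (hmemU v h).1
    simp only [G, if_neg hv] at this
    rw [Finset.sum_sub_distrib]
    linear_combination this
  have hroot : ∀ a, π (ρ a) = a := fun a => hπeq a _ (hsub a (hρ a))
  rw [← sub_eq_zero]
  refine (hIC (π j)).decode (fun v => x v - y v) ?_ (hout j) ?_ ?_
  · have := hG (ρ (π j)) fun h => (hmemU _ h).2 (by rw [hroot])
    simp only [G, hroot, if_pos (hρ _)] at this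
    rw [Finset.sum_sub_distrib, this, sub_self]
  · intro k hk hkI
    have hπk := hπeq _ k hk.2.1
    have := hout k (by rwa [hπk])
    rwa [hπk] at this
  · intro k hk
    exact sub_eq_zero.2 (hside k hk.2.2)
end

section
/- Let D_K be a K-IC structure on N vertices (K ≥ 1) such that the induced subgraph on the non-inner vertices is acyclic. Then β_t(D_K) = N − K + 1 for every message length t, achieved by the ICC scalar linear code; i.e., the ICC scheme is optimal for this class. -/
open Finset
open scoped Classical

universe u

variable {V : Type u}

section Acyclicity

variable {A : V → V → Prop} {s : Finset V}

/-- A walk can be shortened to a path. -/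
lemma exists_nodup_isChain {r : V → V → Prop} {a b : V} (h : Relation.ReflTransGen r a b) :
    ∃ l : List V, l.Nodup ∧ l.IsChain r ∧ l.head? = some a ∧ l.getLast? = some b := by
  induction h using Relation.ReflTransGen.head_induction_on with
  | refl => exact ⟨[b], by simp⟩
  | @head a c hac _ ih =>
    obtain ⟨l, hnd, hch, hh, hl⟩ := ih
    by_cases ha : a ∈ l
    · obtain ⟨p, q, rfl⟩ := List.append_of_mem ha
      refine ⟨a :: q, (List.nodup_append.1 hnd).2.1, (List.isChain_append.1 hch).2.1, rfl, ?_⟩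
      simpa [List.getLast?_append] using hl
    · refine ⟨a :: l, List.nodup_cons.2 ⟨ha, hnd⟩, ?_, rfl, ?_⟩
      · rw [List.isChain_cons]
        refine ⟨fun y hy => ?_, hch⟩
        rw [hh] at hy
        cases hy
        exact hac
      · rw [List.getLast?_cons, hl]
        rfl

lemma AcyclicOn.not_transGen_self (h : AcyclicOn A s) (v : V) :
    ¬ Relation.TransGen (inducedRel A s) v v := by
  intro hv
  obtain ⟨u, hvu, huv⟩ := (Relation.TransGen.tail'_iff).1 hv
  obtain ⟨l, hnd, hch, hh, hl⟩ := exists_nodup_isChain hvu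
  have hne : l ≠ [] := by rintro rfl; simp at hh
  refine h l ⟨hne, hnd, hch.imp fun _ _ hab => hab.2.2, fun a b ha hb => ?_⟩ ?_
  · rw [hl] at ha
    rw [hh] at hb
    cases ha
    cases hb
    exact huv.2.2
  · refine hch.induction (fun x => x ∈ s) l (fun _ _ hab _ => hab.2.1) fun hn => ?_
    rw [List.head?_eq_some_head hn] at hh
    cases hh
    exact huv.2.1

lemma AcyclicOn.nodup (h : AcyclicOn A s) {l : List V} (hc : l.IsChain A)
    (hs : ∀ v ∈ l, v ∈ s) : l.Nodup := by
  have hc' : l.IsChain (Relation.TransGen (inducedRel A s)) := by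
    clear h
    induction l with
    | nil => simp
    | cons a l ih =>
      rw [List.isChain_cons] at hc ⊢
      refine ⟨fun y hy => .single ⟨hs a (by simp), hs y ?_, hc.1 y hy⟩,
        ih hc.2 fun v hv => hs v (by simp [hv])⟩
      exact List.mem_cons_of_mem _ (List.mem_of_mem_head? hy)
  refine hc'.pairwise.imp ?_
  rintro a _ hab rfl
  exact h.not_transGen_self a hab

lemma AcyclicOn.wellFounded [Finite V] (h : AcyclicOn A s) :
    WellFounded fun q v => inducedRel A s v q := by
  have : Std.Irrefl fun q v => Relation.TransGen (inducedRel A s) v q :=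
    ⟨h.not_transGen_self⟩
  have : IsTrans V fun q v => Relation.TransGen (inducedRel A s) v q :=
    ⟨fun _ _ _ hab hbc => hbc.trans hab⟩
  exact Subrelation.wf (fun hab => Relation.TransGen.single hab)
    (Finite.wellFounded_of_trans_of_irrefl fun q v => Relation.TransGen (inducedRel A s) v q)

end Acyclicity

section Walks

variable {A : V → V → Prop} {VI : Finset V}

/-- Arcs leaving a non-inner vertex. -/
def fromOuter (A : V → V → Prop) (VI : Finset V) (u v : V) : Prop := u ∉ VI ∧ A u v

/-- Arcs entering a non-inner vertex. -/
def intoOuter (A : V → V → Prop) (VI : Finset V) (u v : V) : Prop := A u v ∧ v ∉ VI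

/-- The inner vertices reachable from `v` by a walk all of whose vertices but the last are
non-inner. -/
noncomputable def innerReach (A : V → V → Prop) (VI : Finset V) (v : V) : Finset V :=
  VI.filter fun k => Relation.ReflTransGen (fromOuter A VI) v k

lemma innerReach_of_mem {v : V} (hv : v ∈ VI) : innerReach A VI v = {v} := by
  ext k
  simp only [innerReach, mem_filter, mem_singleton]
  constructor
  · rintro ⟨-, h⟩
    rcases h.cases_head with h | ⟨c, hc, -⟩
    · exact h.symm
    · exact absurd hv hc.1
  · rintro rfl
    exact ⟨hv, .refl⟩

lemma innerReach_of_notMem [Fintype V] [DecidableEq V] {v : V} (hv : v ∉ VI) :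
    innerReach A VI v = (univ.filter fun q => A v q).biUnion (innerReach A VI) := by
  ext k
  simp only [innerReach, mem_filter, mem_biUnion, mem_univ, true_and]
  constructor
  · rintro ⟨hk, h⟩
    rcases h.cases_head with rfl | ⟨c, hc, h⟩
    · exact absurd hk hv
    · exact ⟨c, hc.2, hk, h⟩
  · rintro ⟨q, hq, hk, h⟩
    exact ⟨hk, .head ⟨hv, hq⟩ h⟩

lemma exists_walk_fromOuter {q k : V} (h : Relation.ReflTransGen (fromOuter A VI) q k) :
    ∃ D : List V, (D ++ [k]).IsChain A ∧ (∀ v ∈ D, v ∉ VI) ∧ (D ++ [k]).head? = some q := by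
  induction h using Relation.ReflTransGen.head_induction_on with
  | refl => exact ⟨[], by simp⟩
  | @head a c hac _ ih =>
    obtain ⟨D, hch, hD, hh⟩ := ih
    refine ⟨a :: D, ?_, ?_, rfl⟩
    · rw [List.cons_append, List.isChain_cons]
      refine ⟨fun y hy => ?_, hch⟩
      rw [hh] at hy
      cases hy
      exact hac.2
    · simpa using ⟨hac.1, hD⟩

lemma exists_walk_intoOuter {i v : V} (h : Relation.ReflTransGen (intoOuter A VI) i v) :
    ∃ p : List V, (i :: p).IsChain A ∧ (∀ v ∈ p, v ∉ VI) ∧ (i :: p).getLast? = some v := by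
  induction h with
  | refl => exact ⟨[], by simp⟩
  | @tail b c _ hbc ih =>
    obtain ⟨p, hch, hp, hl⟩ := ih
    refine ⟨p ++ [c], ?_, ?_, ?_⟩
    · rw [← List.cons_append, List.isChain_append]
      refine ⟨hch, by simp, fun x hx y hy => ?_⟩
      rw [hl] at hx
      cases hx
      cases hy
      exact hbc.1
    · intro x hx
      rcases List.mem_append.1 hx with hx | hx
      · exact hp x hx
      · rw [List.mem_singleton.1 hx]
        exact hbc.2
    · rw [← List.cons_append, List.getLast?_concat]

lemma isChain_walk_append {i v q k : V} {p D : List V} (hp : (i :: p).IsChain A)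
    (hl : (i :: p).getLast? = some v) (hvq : A v q) (hD : (D ++ [k]).IsChain A)
    (hh : (D ++ [k]).head? = some q) : (i :: ((p ++ D) ++ [k])).IsChain A := by
  rw [List.append_assoc, ← List.cons_append, List.isChain_append]
  refine ⟨hp, hD, fun x hx y hy => ?_⟩
  rw [hl] at hx
  rw [hh] at hy
  cases hx
  cases hy
  exact hvq

lemma reflTransGen_fromOuter_of_isChain {q k : V} {l : List V} (hc : (q :: l).IsChain A)
    (hl : (q :: l).getLast? = some k) (ho : ∀ v ∈ (q :: l).dropLast, v ∉ VI) :
    Relation.ReflTransGen (fromOuter A VI) q k := by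
  induction l generalizing q with
  | nil =>
    cases hl
    exact .refl
  | cons b l ih =>
    rw [List.isChain_cons_cons] at hc
    rw [List.getLast?_cons_cons] at hl
    rw [List.dropLast_cons_cons] at ho
    exact .head ⟨ho q (by simp), hc.1⟩ (ih hc.2 hl fun v hv => ho v (List.mem_cons_of_mem _ hv))

end Walks

section InterlinkedCycle

variable [Fintype V] [DecidableEq V] {A : V → V → Prop} {VI : Finset V}

lemma nodup_outer_walk (hacyc : AcyclicOn A (univ \ VI)) {i k : V} {M : List V}
    (hc : (i :: (M ++ [k])).IsChain A) (hM : ∀ v ∈ M, v ∉ VI) : M.Nodup :=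
  hacyc.nodup (List.isChain_append.1 (List.isChain_cons.1 hc).2).1 fun v hv => by
    simpa using hM v hv

lemma IsKIC.not_closed_walk (hIC : IsKIC A VI) (hacyc : AcyclicOn A (univ \ VI)) {i : V}
    (hi : i ∈ VI) {M : List V} (hM : ∀ v ∈ M, v ∉ VI) : ¬ (i :: (M ++ [i])).IsChain A := by
  intro hc
  refine hIC.2 (i :: M) ⟨⟨by simp, ?_, ?_, ?_⟩, ?_⟩
  · exact List.nodup_cons.2 ⟨fun h => hM i h hi, nodup_outer_walk hacyc hc hM⟩
  · rw [← List.cons_append, List.isChain_append] at hc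
    exact hc.1
  · intro a b ha hb
    rw [← List.cons_append, List.isChain_append] at hc
    cases hb
    exact hc.2.2 a ha i rfl
  · rw [Finset.card_eq_one]
    refine ⟨i, ?_⟩
    ext v
    simp only [List.toFinset_cons, mem_inter, mem_insert, List.mem_toFinset, mem_singleton]
    constructor
    · rintro ⟨h | h, hv⟩
      · exact h
      · exact absurd hv (hM v h)
    · rintro rfl
      exact ⟨.inl rfl, hi⟩

lemma isIPath_of_walk (hacyc : AcyclicOn A (univ \ VI)) {i k : V} (hi : i ∈ VI) (hk : k ∈ VI)
    (hik : i ≠ k) {M : List V} (hM : ∀ v ∈ M, v ∉ VI) (hc : (i :: (M ++ [k])).IsChain A) :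
    IsIPath A VI (i :: (M ++ [k])) i k := by
  refine ⟨⟨?_, hc, rfl, ?_⟩, hi, hk, hik, ?_⟩
  · rw [List.nodup_cons, List.nodup_append]
    refine ⟨?_, nodup_outer_walk hacyc hc hM, by simp, ?_⟩
    · rw [List.mem_append, List.mem_singleton]
      rintro (h | h)
      · exact hM i h hi
      · exact hik h
    · rintro a ha b hb rfl
      rw [List.mem_singleton] at hb
      subst hb
      exact hM a ha hk
  · rw [← List.cons_append, List.getLast?_concat]
  · rw [← List.cons_append, List.dropLast_concat]
    exact hM

lemma IsKIC.notMem_innerReach (hIC : IsKIC A VI) (hacyc : AcyclicOn A (univ \ VI)) {i v q : V}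
    (hi : i ∈ VI) (hv : Relation.ReflTransGen (intoOuter A VI) i v) (hq : A v q) :
    i ∉ innerReach A VI q := by
  intro hiq
  obtain ⟨p, hpc, hp, hpl⟩ := exists_walk_intoOuter hv
  obtain ⟨D, hDc, hD, hDh⟩ := exists_walk_fromOuter (mem_filter.1 hiq).2
  exact hIC.not_closed_walk hacyc hi (List.forall_mem_append.2 ⟨hp, hD⟩)
    (isChain_walk_append hpc hpl hq hDc hDh)

lemma IsKIC.pairwiseDisjoint_innerReach (hIC : IsKIC A VI) (hacyc : AcyclicOn A (univ \ VI))
    {i v : V} (hi : i ∈ VI) (hv : Relation.ReflTransGen (intoOuter A VI) i v) :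
    (↑(univ.filter fun q => A v q) : Set V).PairwiseDisjoint (innerReach A VI) := by
  intro q hq q' hq' hne
  rw [Function.onFun, Finset.disjoint_left]
  intro k hk hk'
  simp only [coe_filter, mem_univ, true_and, Set.mem_ofPred_eq] at hq hq'
  have hik : i ≠ k := by
    rintro rfl
    exact hIC.notMem_innerReach hacyc hi hv hq hk
  obtain ⟨hkI, hqk⟩ := mem_filter.1 hk
  obtain ⟨p, hpc, hp, hpl⟩ := exists_walk_intoOuter hv
  obtain ⟨D, hDc, hD, hDh⟩ := exists_walk_fromOuter hqk
  obtain ⟨D', hDc', hD', hDh'⟩ := exists_walk_fromOuter (mem_filter.1 hk').2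
  have heq := (hIC.1 i hi k hkI hik).unique
    (isIPath_of_walk hacyc hi hkI hik (List.forall_mem_append.2 ⟨hp, hD⟩)
      (isChain_walk_append hpc hpl hq hDc hDh))
    (isIPath_of_walk hacyc hi hkI hik (List.forall_mem_append.2 ⟨hp, hD'⟩)
      (isChain_walk_append hpc hpl hq' hDc' hDh'))
  rw [List.append_assoc, List.append_assoc, List.cons.injEq, List.append_right_inj] at heq
  rw [heq.2, hDh'] at hDh
  exact hne (Option.some.inj hDh).symm

lemma IsKIC.biUnion_innerReach (hIC : IsKIC A VI) (hacyc : AcyclicOn A (univ \ VI)) {i : V}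
    (hi : i ∈ VI) : (univ.filter fun q => A i q).biUnion (innerReach A VI) = VI.erase i := by
  ext k
  simp only [mem_biUnion, mem_filter, mem_univ, true_and, mem_erase]
  constructor
  · rintro ⟨q, hq, hk⟩
    refine ⟨?_, (mem_filter.1 hk).1⟩
    rintro rfl
    exact hIC.notMem_innerReach hacyc hi .refl hq hk
  · rintro ⟨hki, hk⟩
    obtain ⟨l, ⟨⟨-, hc, hh, hl⟩, -, -, -, ho⟩, -⟩ := hIC.1 i hi k hk hki.symm
    match l, hc, hh, hl, ho with
    | [a], _, hh, hl, _ =>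
      cases hh
      cases hl
      exact absurd rfl hki
    | a :: q :: l, hc, hh, hl, ho =>
      cases hh
      have hc' := List.isChain_cons_cons.1 hc
      exact ⟨q, hc'.1, mem_filter.2 ⟨hk, reflTransGen_fromOuter_of_isChain hc'.2 hl ho⟩⟩

/-- If every non-inner symbol is the sum of its out-neighbours' symbols, then the symbol of a
vertex reached from an inner vertex is the sum of the inner symbols reachable from it. -/
lemma IsKIC.eq_sum_innerReach {M : Type*} [AddCommGroup M] (hIC : IsKIC A VI)
    (hacyc : AcyclicOn A (univ \ VI)) {z : V → M}
    (hz : ∀ v ∉ VI, z v = ∑ q ∈ univ.filter (fun q => A v q), z q) {i : V} (hi : i ∈ VI) (v : V)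
    (hv : v ∈ VI ∨ Relation.ReflTransGen (intoOuter A VI) i v) :
    z v = ∑ k ∈ innerReach A VI v, z k := by
  induction v using hacyc.wellFounded.induction with
  | _ v ih =>
    by_cases hvI : v ∈ VI
    · rw [innerReach_of_mem hvI, sum_singleton]
    · have hiv := hv.resolve_left hvI
      rw [innerReach_of_notMem hvI, sum_biUnion (hIC.pairwiseDisjoint_innerReach hacyc hi hiv),
        hz v hvI]
      refine sum_congr rfl fun q hq => ?_
      rw [mem_filter] at hq
      by_cases hqI : q ∈ VI
      · rw [innerReach_of_mem hqI, sum_singleton]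
      · exact ih q ⟨by simpa using hvI, by simpa using hqI, hq.2⟩ (.inr (hiv.tail ⟨hq.2, hqI⟩))

/-- The interlinked-cycle parity checks determine every symbol from its side information. -/
lemma IsKIC.eq_zero_of_parity {M : Type*} [AddCommGroup M] (hIC : IsKIC A VI)
    (hacyc : AcyclicOn A (univ \ VI)) {z : V → M}
    (hz : ∀ v ∉ VI, z v = ∑ q ∈ univ.filter (fun q => A v q), z q)
    (hsum : ∑ k ∈ VI, z k = 0) (i : V) (hi : ∀ q, A i q → z q = 0) : z i = 0 := by
  have hnbr : ∑ q ∈ univ.filter (fun q => A i q), z q = 0 :=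
    sum_eq_zero fun q hq => hi q (mem_filter.1 hq).2
  by_cases hiI : i ∈ VI
  · have herase : ∑ k ∈ VI.erase i, z k = 0 := by
      rw [← hIC.biUnion_innerReach hacyc hiI,
        sum_biUnion (hIC.pairwiseDisjoint_innerReach hacyc hiI .refl), ← hnbr]
      refine sum_congr rfl fun q hq => (hIC.eq_sum_innerReach hacyc hz hiI q ?_).symm
      by_cases hqI : q ∈ VI
      · exact .inl hqI
      · exact .inr (.single ⟨(mem_filter.1 hq).2, hqI⟩)
    rwa [← add_sum_erase _ _ hiI, herase, add_zero] at hsum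
  · rw [hz i hiI, hnbr]

lemma IsKIC.exists_indexCode (hIC : IsKIC A VI) (hacyc : AcyclicOn A (univ \ VI)) (t : ℕ) :
    ∃ F, IsIndexCode A t ((Fintype.card V - VI.card + 1) * t) F := by
  have hcard : Fintype.card (Option {v // v ∉ VI} × Fin t) =
      (Fintype.card V - VI.card + 1) * t := by
    rw [Fintype.card_prod, Fintype.card_option, Fintype.card_fin,
      Fintype.card_subtype_compl, Fintype.card_coe]
  let e := Fintype.equivFinOfCardEq hcard
  let w (x : V → Fin t → ZMod 2) (o : Option {v // v ∉ VI}) : Fin t → ZMod 2 :=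
    o.elim (∑ k ∈ VI, x k) fun v => x v - ∑ q ∈ univ.filter (fun q => A v q), x q
  refine ⟨fun x n => w x (e.symm n).1 (e.symm n).2, fun x y hxy i hi => ?_⟩
  have hw (o) : w x o = w y o := by
    funext b
    simpa using congrFun hxy (e (o, b))
  rw [← sub_eq_zero]
  refine hIC.eq_zero_of_parity hacyc (z := fun v => x v - y v) (fun v hv => ?_) ?_ i
    fun q hq => sub_eq_zero.2 (hi q hq)
  · have := hw (some ⟨v, hv⟩)
    simp only [w, Option.elim_some] at this
    rw [sum_sub_distrib, sub_eq_sub_iff_sub_eq_sub]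
    exact this
  · rw [sum_sub_distrib, sub_eq_zero]
    exact hw none

lemma IsKIC.acyclicOn_insert (hIC : IsKIC A VI) (hacyc : AcyclicOn A (univ \ VI)) {i : V}
    (hi : i ∈ VI) : AcyclicOn A (insert i (univ \ VI)) := by
  intro l hl hmem
  by_cases hil : i ∈ l
  · refine hIC.2 l ⟨hl, Finset.card_eq_one.2 ⟨i, ?_⟩⟩
    ext v
    simp only [mem_inter, List.mem_toFinset, mem_singleton]
    constructor
    · rintro ⟨hv, hvI⟩
      simpa [hvI] using hmem v hv
    · rintro rfl
      exact ⟨hil, hi⟩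
  · refine hacyc l hl fun v hv => (mem_insert.1 (hmem v hv)).resolve_left ?_
    rintro rfl
    exact hil hv

end InterlinkedCycle

/-- An acyclic induced subdigraph bounds the length of every index code from below. -/
lemma IsIndexCode.card_mul_le [Fintype V] {A : V → V → Prop} {s : Finset V} (hs : AcyclicOn A s)
    {t p : ℕ} {F : (V → (Fin t → ZMod 2)) → (Fin p → ZMod 2)} (hF : IsIndexCode A t p F) :
    s.card * t ≤ p := by
  let extendZero (x : s → Fin t → ZMod 2) (v : V) : Fin t → ZMod 2 := if h : v ∈ s then x ⟨v, h⟩ else 0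
  have hinj : Function.Injective fun x => F (extendZero x) := by
    intro x y hxy
    have key (v : V) : extendZero x v = extendZero y v := by
      induction v using hs.wellFounded.induction with
      | _ v ih =>
        by_cases hv : v ∈ s
        · refine hF _ _ hxy v fun q hq => ?_
          by_cases hqs : q ∈ s
          · exact ih q ⟨hv, hqs, hq⟩
          · simp [extendZero, hqs]
        · simp [extendZero, hv]
    funext v
    simpa [extendZero] using key v
  have hcard := Fintype.card_le_of_injective _ hinj
  simp only [Fintype.card_fun, Fintype.card_fin, ZMod.card, Fintype.card_coe] at hcard
  rw [← pow_mul, mul_comm] at hcard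
  exact (Nat.pow_le_pow_iff_right (by norm_num)).1 hcard

/-- Optimality of the ICC scheme for K-IC structures whose non-inner part is acyclic:
β_t(D_K) = N − K + 1 for every message length t, achieved by a scalar linear code. -/
theorem stmt12 {V : Type u} [Fintype V] [DecidableEq V] (A : V → V → Prop)
    (VI : Finset V) (K : ℕ) (hK : VI.card = K) (hK1 : 1 ≤ K)
    (hIC : IsKIC A VI) (hacyc : AcyclicOn A (univ \ VI)) :
    ∀ t : ℕ, 1 ≤ t →
      (∃ F, IsIndexCode A t ((Fintype.card V - K + 1) * t) F) ∧
      (∀ (p : ℕ) (F : (V → (Fin t → ZMod 2)) → (Fin p → ZMod 2)),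
        IsIndexCode A t p F → (Fintype.card V - K + 1) * t ≤ p) := by
  subst hK
  intro t _
  refine ⟨hIC.exists_indexCode hacyc t, fun p F hF => ?_⟩
  obtain ⟨i, hi⟩ := Finset.card_pos.1 hK1
  have h := hF.card_mul_le (hIC.acyclicOn_insert hacyc hi)
  rwa [card_insert_of_notMem (by simp [hi]), card_sdiff_of_subset (subset_univ _),
    card_univ] at h
end

section
/- In a 3-IC structure D_3 with inner vertices {a, b, c}, there is no directed cycle consisting entirely of non-inner vertices. -/
open Finset
open scoped Classical

universe u

variable {V : Type u}

lemma isIPath_iff [DecidableEq V] {A : V → V → Prop} {VI : Finset V} {l : List V} {i j : V} :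
    IsIPath A VI l i j ↔ ∃ m, l = i :: (m ++ [j]) ∧ l.Nodup ∧ l.IsChain A ∧ i ∈ VI ∧ j ∈ VI ∧
      i ≠ j ∧ ∀ v ∈ m, v ∉ VI := by
  constructor
  · rintro ⟨⟨hn, hc, hh, hl⟩, hi, hj, hij, hm⟩
    obtain _ | ⟨x, t⟩ := l
    · simp at hh
    obtain rfl : x = i := by simpa using hh
    rcases List.eq_nil_or_concat t with rfl | ⟨m, y, rfl⟩
    · simp at hl
      exact absurd hl hij
    rw [List.concat_eq_append] at *
    have hy : y = j := by
      rw [← List.cons_append, List.getLast?_concat] at hl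
      simpa using hl
    subst hy
    refine ⟨m, rfl, hn, hc, hi, hj, hij, fun v hv => hm v ?_⟩
    rw [← List.cons_append, List.dropLast_concat]
    simpa using hv
  · rintro ⟨m, rfl, hn, hc, hi, hj, hij, hm⟩
    refine ⟨⟨hn, hc, rfl, ?_⟩, hi, hj, hij, ?_⟩
    · rw [← List.cons_append, List.getLast?_concat]
    · rw [← List.cons_append, List.dropLast_concat]
      simpa using hm

lemma IsIPath.reverse [DecidableEq V] {A : V → V → Prop} {VI : Finset V} {l : List V} {i j : V}
    (h : IsIPath A VI l i j) : IsIPath (flip A) VI l.reverse j i := by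
  obtain ⟨m, rfl, hn, hc, hi, hj, hij, hm⟩ := isIPath_iff.1 h
  refine isIPath_iff.2 ⟨m.reverse, by simp, List.nodup_reverse.2 hn, ?_, hj, hi, hij.symm, ?_⟩
  · exact List.isChain_reverse.2 hc
  · simpa using hm

lemma List.exists_last_split {α : Type*} {p : α → Prop} {m : List α} (h : ∃ x ∈ m, p x) :
    ∃ m₁ y m₂, m = m₁ ++ y :: m₂ ∧ p y ∧ ∀ z ∈ m₂, ¬ p z := by
  induction m with
  | nil => simp at h
  | cons a t ih =>
    by_cases ht : ∃ x ∈ t, p x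
    · obtain ⟨m₁, y, m₂, rfl, hy, hz⟩ := ih ht
      exact ⟨a :: m₁, y, m₂, rfl, hy, hz⟩
    · refine ⟨[], a, t, rfl, ?_, by simpa using ht⟩
      obtain ⟨x, hx, hpx⟩ := h
      rcases List.mem_cons.1 hx with rfl | hx
      · exact hpx
      · exact absurd ⟨x, hx, hpx⟩ ht

/-- I-paths are determined by their endpoints. -/
def UniqueIPaths [DecidableEq V] (A : V → V → Prop) (VI : Finset V) : Prop :=
  ∀ i j l l', IsIPath A VI l i j → IsIPath A VI l' i j → l = l'

/-- A non-inner vertex has the same position on all I-paths with a common start. -/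
lemma UniqueIPaths.idxOf_eq [DecidableEq V] {A : V → V → Prop} {VI : Finset V}
    (hu : UniqueIPaths A VI) {i j k x : V} {l l' : List V} (h : IsIPath A VI l i j)
    (h' : IsIPath A VI l' i k) (hx : x ∈ l) (hx' : x ∈ l') (hxI : x ∉ VI) :
    l.idxOf x = l'.idxOf x := by
  rcases eq_or_ne j k with rfl | hjk
  · rw [hu _ _ _ _ h h']
  obtain ⟨m, rfl, hn, hc, hi, hj, hij, hm⟩ := isIPath_iff.1 h
  obtain ⟨n, rfl, hn', hc', -, hk, hik, hm'⟩ := isIPath_iff.1 h'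
  have hxm : x ∈ m := by grind
  have hxn : x ∈ n := by grind
  obtain ⟨m₁, y, m₂, rfl, hy, hz⟩ := List.exists_last_split (p := (· ∈ n)) ⟨x, hxm, hxn⟩
  obtain ⟨n₁, n₂, rfl⟩ := List.append_of_mem hy
  have key : IsIPath A VI (i :: ((n₁ ++ y :: m₂) ++ [j])) i j := by
    have e : i :: ((n₁ ++ y :: m₂) ++ [j]) = (i :: n₁) ++ y :: (m₂ ++ [j]) := by simp
    have e₁ : i :: ((m₁ ++ y :: m₂) ++ [j]) = (i :: m₁) ++ y :: (m₂ ++ [j]) := by simp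
    have e₂ : i :: ((n₁ ++ y :: n₂) ++ [k]) = (i :: n₁) ++ y :: (n₂ ++ [k]) := by simp
    rw [e₁] at hn hc
    rw [e₂] at hn' hc'
    refine isIPath_iff.2 ⟨_, rfl, ?_, ?_, hi, hj, hij, by grind⟩
    · rw [e]
      refine hn'.of_append_left.append hn.of_append_right ?_
      have hdn := List.disjoint_of_nodup_append hn
      have hdn' := List.disjoint_of_nodup_append hn'
      intro z hz₁ hz₂
      have hzy : z ≠ y := fun h => hdn' hz₁ (by simp [h])
      have hzi : z ≠ i := fun h => hdn (by simp [h]) hz₂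
      have hzn : z ∈ n₁ := by simpa [hzi] using hz₁
      have hzI : z ∉ VI := hm' z (by simp [hzn])
      have hzj : z ≠ j := fun h => hzI (h ▸ hj)
      exact hz z (by simpa [hzy, hzj] using hz₂) (by simp [hzn])
    · rw [List.isChain_split] at hc hc'
      rw [e, List.isChain_split]
      exact ⟨hc'.1, hc.2⟩
  have e := hu _ _ _ _ h key
  obtain rfl : m₁ = n₁ := by simpa using e
  have hmem : x ∈ i :: (m₁ ++ [y]) := by grind
  have e₁ : i :: ((m₁ ++ y :: m₂) ++ [j]) = (i :: (m₁ ++ [y])) ++ (m₂ ++ [j]) := by simp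
  have e₂ : i :: ((m₁ ++ y :: n₂) ++ [k]) = (i :: (m₁ ++ [y])) ++ (n₂ ++ [k]) := by simp
  rw [e₁, e₂, List.idxOf_append_of_mem hmem, List.idxOf_append_of_mem hmem]

/-- The I-paths leaving `i` form an out-tree: some depth function grows by one along each of
their arcs between non-inner vertices. -/
lemma UniqueIPaths.exists_depth [DecidableEq V] {A : V → V → Prop} {VI : Finset V}
    (hu : UniqueIPaths A VI) (i : V) :
    ∃ f : V → ℕ, ∀ l j u v, IsIPath A VI l i j → u ∉ VI → v ∉ VI → [u, v] <:+: l →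
      f v = f u + 1 := by
  have hf : ∀ x, ∃ n : ℕ, x ∉ VI → ∀ l j, IsIPath A VI l i j → x ∈ l → l.idxOf x = n := by
    intro x
    by_cases hx : x ∉ VI ∧ ∃ l j, IsIPath A VI l i j ∧ x ∈ l
    · obtain ⟨hxI, l, j, hl, hxl⟩ := hx
      exact ⟨l.idxOf x, fun _ l' j' hl' hxl' => hu.idxOf_eq hl' hl hxl' hxl hxI⟩
    · exact ⟨0, fun hxI l j hl hxl => absurd ⟨hxI, l, j, hl, hxl⟩ hx⟩
  choose f hf using hf
  refine ⟨f, fun l j u v hl hu' hv' huv => ?_⟩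
  rw [← hf u hu' l j hl (huv.subset (by simp)), ← hf v hv' l j hl (huv.subset (by simp))]
  obtain ⟨s, t, rfl⟩ := huv
  have hn := hl.1.1
  have hus : u ∉ s := by grind [List.nodup_append]
  have hvs : v ∉ s := by grind [List.nodup_append]
  have huv' : u ≠ v := by grind [List.nodup_append]
  simp [List.idxOf_append, hus, hvs, huv', Nat.add_comm]

lemma Relation.ReflTransGen.exists_nodup_isChain {α : Type*} {r : α → α → Prop} {x y : α}
    (h : Relation.ReflTransGen r x y) :
    ∃ m : List α, (x :: m).Nodup ∧ (x :: m).IsChain r ∧ (x :: m).getLast? = some y := by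
  induction h using Relation.ReflTransGen.head_induction_on with
  | refl => exact ⟨[], by simp⟩
  | @head x z hxz _ ih =>
    obtain ⟨m, hn, hc, hl⟩ := ih
    by_cases hx : x ∈ z :: m
    · obtain ⟨s, t, hst⟩ := List.append_of_mem hx
      rw [hst] at hn hc hl
      exact ⟨t, hn.of_append_right, hc.right_of_append, by simpa using hl⟩
    · exact ⟨z :: m, List.nodup_cons.2 ⟨hx, hn⟩, List.isChain_cons_cons.2 ⟨hxz, hc⟩,
        by simpa using hl⟩

lemma List.IsChain.reflTransGen_of_append {α : Type*} {r : α → α → Prop} {x y : α} {s t : List α}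
    (h : (x :: (s ++ y :: t)).IsChain r) : Relation.ReflTransGen r x y := by
  induction s generalizing x with
  | nil => exact .single (List.isChain_cons_cons.1 h).1
  | cons z s ih => exact .head (List.isChain_cons_cons.1 h).1 (ih (List.isChain_cons_cons.1 h).2)

lemma forall_mem_of_isChain {α : Type*} {r : α → α → Prop} {p : α → Prop} {x : α} {m : List α}
    (h : (x :: m).IsChain (fun u v => r u v ∧ p v)) : ∀ v ∈ m, p v := by
  induction m generalizing x with
  | nil => simp
  | cons z m ih =>
    rw [List.isChain_cons_cons] at h
    exact List.forall_mem_cons.2 ⟨h.1.2, ih h.2⟩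

/-- A closed walk meeting the inner vertices only at `i` yields an I-cycle. -/
lemma exists_isICycle [DecidableEq V] {A : V → V → Prop} {VI : Finset V} {i y : V} (hi : i ∈ VI)
    (h : Relation.ReflTransGen (fun u v => A u v ∧ v ∉ VI) i y) (hy : A y i) :
    ∃ l, IsICycle A VI l := by
  obtain ⟨m, hn, hc, hl⟩ := h.exists_nodup_isChain
  have hm := forall_mem_of_isChain hc
  refine ⟨i :: m, ⟨by simp, hn, hc.imp fun _ _ h => h.1, ?_⟩, ?_⟩
  · intro p q hp hq
    obtain rfl : y = p := by simpa [hl] using hp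
    obtain rfl : i = q := by simpa using hq
    exact hy
  · rw [Finset.card_eq_one]
    refine ⟨i, ?_⟩
    ext v
    simp only [List.mem_toFinset, Finset.mem_inter, List.mem_cons, Finset.mem_singleton]
    grind

lemma List.IsChain.reflTransGen_getLast {α : Type*} {r : α → α → Prop} {x y : α} {t : List α}
    (h : (x :: t).IsChain r) (hy : (x :: t).getLast? = some y) : Relation.ReflTransGen r x y := by
  rw [List.getLast?_eq_some_getLast (by simp), Option.some_inj] at hy
  exact List.relationReflTransGen_of_exists_isChain_cons t h hy

lemma IsIPath.reflTransGen [DecidableEq V] {A : V → V → Prop} {VI : Finset V} {l : List V}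
    {i j v : V} (h : IsIPath A VI l i j) (hv : v ∈ l) (hvI : v ∉ VI) :
    Relation.ReflTransGen (fun u v => A u v ∧ v ∉ VI) i v ∧
      ∃ y, Relation.ReflTransGen (fun u v => A u v ∧ v ∉ VI) v y ∧ A y j := by
  obtain ⟨m, rfl, -, hc, hi, hj, -, hm⟩ := isIPath_iff.1 h
  have hvm : v ∈ m := by grind
  obtain ⟨s, t, rfl⟩ := List.append_of_mem hvm
  rw [← List.cons_append, List.isChain_append] at hc
  obtain ⟨hc, -, hlast⟩ := hc
  have hc' : (i :: (s ++ v :: t)).IsChain (fun u v => A u v ∧ v ∉ VI) :=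
    hc.imp_of_mem_tail_imp fun x y _ hy hxy => ⟨hxy, hm y (by simpa using hy)⟩
  refine ⟨hc'.reflTransGen_of_append, (v :: t).getLast (by simp), ?_, ?_⟩
  · have hvt : (v :: t).IsChain (fun u v => A u v ∧ v ∉ VI) :=
      List.IsChain.right_of_append (l₁ := i :: s) hc'
    exact hvt.reflTransGen_getLast (List.getLast?_eq_some_getLast _)
  · refine hlast _ ?_ j (by simp)
    rw [← List.cons_append, List.getLast?_append_of_ne_nil _ (by simp)]
    exact List.getLast?_eq_some_getLast _

lemma IsCycle.reflTransGen {A : V → V → Prop} {l : List V} (h : IsCycle A l) {p : V → Prop}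
    (hp : ∀ v ∈ l, p v) {u v : V} (hu : u ∈ l) (hv : v ∈ l) :
    Relation.ReflTransGen (fun u v => A u v ∧ p v) u v := by
  obtain ⟨hne, -, hc, hw⟩ := h
  have hc' : l.IsChain (fun u v => A u v ∧ p v) :=
    List.IsChain.imp_of_mem_imp (fun x y _ hy hxy => ⟨hxy, hp y hy⟩) hc
  have hlast : Relation.ReflTransGen (fun u v => A u v ∧ p v) u (l.getLast hne) := by
    obtain ⟨s, t, rfl⟩ := List.append_of_mem hu
    refine hc'.right_of_append.reflTransGen_getLast ?_
    rw [← List.getLast?_eq_some_getLast, List.getLast?_append_of_ne_nil _ (by simp)]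
  have hhead : Relation.ReflTransGen (fun u v => A u v ∧ p v) (l.head hne) v := by
    obtain _ | ⟨x, t⟩ := l
    · exact absurd rfl hne
    rcases List.mem_cons.1 hv with rfl | hv
    · exact .refl
    · obtain ⟨s, t, rfl⟩ := List.append_of_mem hv
      exact hc'.reflTransGen_of_append
  exact (hlast.tail ⟨hw _ _ (List.getLast?_eq_some_getLast _) (List.head?_eq_some_head _),
    hp _ (List.head_mem _)⟩).trans hhead

lemma IsCycle.exists_succ {A : V → V → Prop} {l : List V} (h : IsCycle A l) {u : V}
    (hu : u ∈ l) : ∃ v ∈ l, A u v := by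
  obtain ⟨s, t, rfl⟩ := List.append_of_mem hu
  obtain ⟨-, -, hc, hw⟩ := h
  obtain _ | ⟨v, t⟩ := t
  · obtain ⟨b, hb⟩ : ∃ b, (s ++ [u]).head? = some b := by cases s <;> simp
    exact ⟨b, List.mem_of_head? hb, hw _ _ (by simp) hb⟩
  · exact ⟨v, by simp, (List.isChain_cons_cons.1 hc.right_of_append).1⟩

/-- In a 3-IC structure with inner vertices {a,b,c} in which every vertex and arc lies on
some I-path, there is no directed cycle consisting entirely of non-inner vertices. -/
theorem stmt13 {V : Type u} [DecidableEq V] (A : V → V → Prop) (a b c : V)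
    (hab : a ≠ b) (hbc : b ≠ c) (hac : a ≠ c)
    (hIC : IsKIC A ({a, b, c} : Finset V))
    (hvcover : ∀ v : V, ∃ i ∈ ({a, b, c} : Finset V), ∃ j ∈ ({a, b, c} : Finset V),
      ∃ l : List V, IsIPath A {a, b, c} l i j ∧ v ∈ l)
    (hacover : ∀ u v : V, A u v → ∃ i ∈ ({a, b, c} : Finset V),
      ∃ j ∈ ({a, b, c} : Finset V),
      ∃ l : List V, IsIPath A {a, b, c} l i j ∧ [u, v] <:+: l) :
    ∀ l : List V, IsCycle A l → ¬ (∀ v ∈ l, v ∉ ({a, b, c} : Finset V)) := by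
  intro l hl hout
  have hu : UniqueIPaths A {a, b, c} := fun i j l l' h h' =>
    (hIC.1 i h.2.1 j h.2.2.1 h.2.2.2.1).unique h h'
  have hu' : UniqueIPaths (flip A) {a, b, c} := fun i j l l' h h' =>
    List.reverse_injective (hu _ _ _ _ h.reverse h'.reverse)
  have hex : ∀ u : {u // u ∈ l}, ∃ v ∈ l, ∃ i ∈ ({a, b, c} : Finset V),
      ∃ j ∈ ({a, b, c} : Finset V), ∃ P, IsIPath A {a, b, c} P i j ∧ [u.1, v] <:+: P := by
    rintro ⟨u, hul⟩
    obtain ⟨v, hv, huv⟩ := hl.exists_succ hul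
    exact ⟨v, hv, hacover u v huv⟩
  choose v hv s hs e he P hP huv using hex
  have hse : ∀ u w, s u ≠ e w := by
    intro u w h
    have h₁ := ((hP u).reflTransGen ((huv u).subset (by simp)) (hout _ u.2)).1
    obtain ⟨y, h₂, hy⟩ := ((hP w).reflTransGen ((huv w).subset (by simp)) (hout _ w.2)).2
    obtain ⟨C, hC⟩ := exists_isICycle (hs u)
      ((h₁.trans (hl.reflTransGen hout u.2 w.2)).trans h₂) (h ▸ hy)
    exact hIC.2 C hC
  obtain ⟨u₀, hu₀⟩ := List.exists_mem_of_ne_nil l hl.1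
  have hne : l.toFinset.Nonempty := ⟨u₀, by simpa using hu₀⟩
  by_cases hcase : ∀ u, s u = s ⟨u₀, hu₀⟩
  · obtain ⟨f, hf⟩ := hu.exists_depth (s ⟨u₀, hu₀⟩)
    obtain ⟨x, hx, hmax⟩ := l.toFinset.exists_max_image f hne
    rw [List.mem_toFinset] at hx
    have h₁ := hf _ _ _ _ (hcase ⟨x, hx⟩ ▸ hP ⟨x, hx⟩) (hout _ hx) (hout _ (hv ⟨x, hx⟩))
      (huv ⟨x, hx⟩)
    have h₂ := hmax _ (List.mem_toFinset.2 (hv ⟨x, hx⟩))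
    omega
  · push Not at hcase
    obtain ⟨w, hw⟩ := hcase
    have hcase' : ∀ u, e u = e ⟨u₀, hu₀⟩ := by
      intro u
      have h₁ := hs w
      have h₂ := hs ⟨u₀, hu₀⟩
      have h₃ := he u
      have h₄ := he ⟨u₀, hu₀⟩
      have h₅ := hse w u
      have h₆ := hse w ⟨u₀, hu₀⟩
      have h₇ := hse ⟨u₀, hu₀⟩ u
      have h₈ := hse ⟨u₀, hu₀⟩ ⟨u₀, hu₀⟩
      simp only [Finset.mem_insert, Finset.mem_singleton] at h₁ h₂ h₃ h₄
      grind
    obtain ⟨f, hf⟩ := hu'.exists_depth (e ⟨u₀, hu₀⟩)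
    obtain ⟨x, hx, hmin⟩ := l.toFinset.exists_min_image f hne
    rw [List.mem_toFinset] at hx
    have h₁ := hf _ _ _ _ (hcase' ⟨x, hx⟩ ▸ (hP ⟨x, hx⟩).reverse) (hout _ (hv ⟨x, hx⟩))
      (hout _ hx) (by simpa using List.reverse_infix.2 (huv ⟨x, hx⟩))
    have h₂ := hmin _ (List.mem_toFinset.2 (hv ⟨x, hx⟩))
    omega
end
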